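/- arXiv:1212.2668 — 9 statements merged into one kernel-verified Lean document; each statement's English description precedes it below -/
import Mathlib

section
/- For any finite alphabet 𝒳, any probability mass function P_X on 𝒳, any injective compressor f: 𝒳 → {0,1}*, and any optimal compressor f* (one that assigns the elements of 𝒳, listed in order of decreasing probability, the binary strings in lexicographic order ∅,0,1,00,01,10,11,000,…), the following stochastic dominance holds: for every integer k ≥ 0, P[ℓ(f(X)) ≥ k] ≥ P[ℓ(f*(X)) ≥ k]. -/
open scoped BigOperators

/-- Probability of an event under a (countably supported) probability mass function. -/
noncomputable def prob {α : Type*} (P : α → ℝ) (s : Set α) : ℝ := ∑' x, s.indicator P x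

/-- `g` is an optimal fixed-to-variable compressor for the pmf `P`: it is injective and there
is a ranking of the alphabet by decreasing probability (the rank-`m` element being the
`(m+1)`-st most probable, with ranks forming an initial segment of `ℕ`) such that the element
of rank `m` receives the `(m+1)`-st binary string in the lexicographic order
`∅,0,1,00,01,10,11,000,…`, i.e. a string of length `⌊log₂ (m+1)⌋`. -/
def IsOptimalCode {α : Type*} (P : α → ℝ) (g : α → List Bool) : Prop :=
  Function.Injective g ∧
  ∃ rank : α → ℕ,
    Function.Injective rank ∧
    (∀ x m, m ≤ rank x → ∃ y, rank y = m) ∧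
    (∀ x y, rank x ≤ rank y → P y ≤ P x) ∧
    (∀ x, (g x).length = Nat.log 2 (rank x + 1))

theorem card_le_of_injOn_length_lt {α : Type*} (s : Finset α) (f : α → List Bool)
    (hf : Set.InjOn f s) (k : ℕ) (hs : ∀ x ∈ s, (f x).length < k) :
    s.card ≤ 2 ^ k - 1 := by
  let e : s → Σ i : Fin k, List.Vector Bool i :=
    fun x => ⟨⟨(f x).length, hs x x.2⟩, ⟨f x, rfl⟩⟩
  have he : Function.Injective e := by
    have hcode : ∀ x : s, (e x).2.toList = f x := fun _ => rfl
    intro x y hxy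
    apply Subtype.ext
    apply hf x.2 y.2
    rw [← hcode x, ← hcode y, hxy]
  have hcard := Fintype.card_le_of_injective e he
  rw [Fintype.card_coe, Fintype.card_sigma] at hcard
  simp only [card_vector, Fintype.card_bool] at hcard
  rwa [Fin.sum_univ_eq_sum_range (fun i => 2 ^ i) k, Nat.geomSum_eq le_rfl,
    Nat.div_one] at hcard

/-- If the values of `P` on `s` are at least `c ≥ 0` and its values off `s` are at most `c`, then
no set with at most as many elements as `s` has a larger `P`-sum. -/
theorem sum_le_sum_of_card_le_of_threshold {α : Type*} (P : α → ℝ)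
    {s t : Finset α} {c : ℝ} (hc : 0 ≤ c) (hs : ∀ x ∈ s, c ≤ P x) (hsc : ∀ x ∉ s, P x ≤ c)
    (hcard : t.card ≤ s.card) : ∑ x ∈ t, P x ≤ ∑ x ∈ s, P x := by
  classical
  rw [← Finset.sum_sdiff_le_sum_sdiff]
  calc ∑ x ∈ t \ s, P x ≤ (t \ s).card • c :=
        Finset.sum_le_card_nsmul _ _ _ fun x hx => hsc x (Finset.mem_sdiff.1 hx).2
    _ ≤ (s \ t).card • c :=
        nsmul_le_nsmul_left hc (Finset.card_sdiff_le_card_sdiff_iff.2 hcard)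
    _ ≤ ∑ x ∈ s \ t, P x :=
        Finset.card_nsmul_le_sum _ _ _ fun x hx => hs x (Finset.mem_sdiff.1 hx).1

theorem sum_le_sum_rank_lt {α : Type*} [Fintype α] (P : α → ℝ) (hP : ∀ x, 0 ≤ P x)
    (rank : α → ℕ) (hsurj : ∀ x m, m ≤ rank x → ∃ y, rank y = m)
    (hanti : ∀ x y, rank x ≤ rank y → P y ≤ P x) (n : ℕ) (t : Finset α) (ht : t.card ≤ n) :
    ∑ x ∈ t, P x ≤ ∑ x with rank x < n, P x := by
  classical
  by_cases hall : ∀ x, rank x < n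
  · exact Finset.sum_le_sum_of_subset_of_nonneg (fun x _ => by simp [hall])
      fun x _ _ => hP x
  push Not at hall
  obtain ⟨x, hx⟩ := hall
  obtain ⟨y, hy⟩ := hsurj x n hx
  refine sum_le_sum_of_card_le_of_threshold P (hP y) ?_ ?_ (ht.trans ?_)
  · intro z hz
    exact hanti z y (hy ▸ (Finset.mem_filter.1 hz).2.le)
  · intro z hz
    exact hanti y z (by simpa [hy] using hz)
  · have hsub : Finset.range n ⊆ (Finset.univ.filter fun x => rank x < n).image rank := by
      intro m hm
      have hmn := Finset.mem_range.1 hm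
      obtain ⟨z, rfl⟩ := hsurj x m (hmn.le.trans hx)
      exact Finset.mem_image_of_mem _ (by simpa using hmn)
    simpa using (Finset.card_le_card hsub).trans Finset.card_image_le

theorem prob_setOf_le_eq_sub {α : Type*} [Fintype α] (P : α → ℝ) (u : α → ℕ) (k : ℕ) :
    prob P {x | k ≤ u x} = ∑ x, P x - ∑ x with u x < k, P x := by
  classical
  rw [prob, tsum_fintype, eq_sub_iff_add_eq, Finset.sum_filter, ← Finset.sum_add_distrib]
  refine Finset.sum_congr rfl fun x _ => ?_
  by_cases h : k ≤ u x <;> simp [Set.indicator, h]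

/-- Stochastic (competitive) optimality of the optimal compressor: for any losslessly
decodable (injective) compressor `f` and any optimal compressor `g`,
`P[ℓ(f(X)) ≥ k] ≥ P[ℓ(g(X)) ≥ k]` for every `k ≥ 0`. -/
theorem optimal_code_stochastic_dominance
    {𝒳 : Type*} [Fintype 𝒳] (P : 𝒳 → ℝ)
    (hP0 : ∀ x, 0 ≤ P x) (hP1 : ∑ x, P x = 1)
    (f : 𝒳 → List Bool) (hf : Function.Injective f)
    (g : 𝒳 → List Bool) (hg : IsOptimalCode P g)
    (k : ℕ) :
    prob P {x | k ≤ (g x).length} ≤ prob P {x | k ≤ (f x).length} := by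
  obtain ⟨-, rank, -, hsurj, hanti, hlen⟩ := hg
  have hrank : ∀ x, (g x).length < k ↔ rank x < 2 ^ k - 1 := fun x => by
    rw [hlen, Nat.log_lt_iff_lt_pow one_lt_two (Nat.succ_ne_zero _), Nat.lt_sub_iff_add_lt]
  rw [prob_setOf_le_eq_sub P (fun x => (g x).length),
    prob_setOf_le_eq_sub P (fun x => (f x).length)]
  simp only [hrank]
  exact sub_le_sub_left (sum_le_sum_rank_lt P hP0 rank hsurj hanti _ _
    (card_le_of_injOn_length_lt _ f hf.injOn k fun x hx => (Finset.mem_filter.1 hx).2)) _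
end

section
/- Let the source alphabet 𝒜 be finite with all n-strings having positive probability under P_{X^n}. For every n ≥ 1 and every integer k ≥ 1: ε_p(n, k+1) = ε*(n, k) if k < n·log₂|𝒜|, and ε_p(n, k+1) = 0 if k ≥ n·log₂|𝒜|. Here ε*(n,k) is the minimum over all injective compressors f_n: 𝒜^n → {0,1}* of P[ℓ(f_n(X^n)) ≥ k], and ε_p(n,k) is the same minimum restricted to compressors whose images form a prefix-free code. -/
open scoped BigOperators

/-- The range of `f` is a prefix-free code: no codeword of a distinct element is a prefix of
another codeword. -/
def PrefixFree {α : Type*} (f : α → List Bool) : Prop :=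
  ∀ x y, x ≠ y → ¬ (f x <+: f y)

/-- `ε*(k)`: the smallest probability, over all injective compressors `f`, that the
codelength is at least `k`. -/
noncomputable def epsStar {α : Type*} (P : α → ℝ) (k : ℕ) : ℝ :=
  sInf {p : ℝ | ∃ f : α → List Bool, Function.Injective f ∧
    p = prob P {x | k ≤ (f x).length}}

/-- `ε_p(k)`: the smallest probability, over all injective prefix-free compressors `f`,
that the codelength is at least `k`. -/
noncomputable def epsPre {α : Type*} (P : α → ℝ) (k : ℕ) : ℝ :=
  sInf {p : ℝ | ∃ f : α → List Bool, Function.Injective f ∧ PrefixFree f ∧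
    p = prob P {x | k ≤ (f x).length}}

theorem prob_nonneg {α : Type*} {P : α → ℝ} (hP : ∀ x, 0 ≤ P x) (s : Set α) : 0 ≤ prob P s :=
  tsum_nonneg fun x => Set.indicator_nonneg (fun x _ => hP x) x

theorem prob_mono {α : Type*} [Finite α] {P : α → ℝ} (hP : ∀ x, 0 ≤ P x) {s t : Set α}
    (h : s ⊆ t) : prob P s ≤ prob P t := by
  have := Fintype.ofFinite α
  simp only [prob, tsum_fintype]
  exact Finset.sum_le_sum fun x _ => Set.indicator_le_indicator_of_subset h hP x

/-- The binary strings of length `k`. -/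
def stringsOfLength (k : ℕ) : Finset (List Bool) :=
  Finset.univ.image (List.ofFn : (Fin k → Bool) → List Bool)

theorem mem_stringsOfLength {k : ℕ} {l : List Bool} : l ∈ stringsOfLength k ↔ l.length = k := by
  simp only [stringsOfLength, Finset.mem_image, Finset.mem_univ, true_and]
  constructor
  · rintro ⟨v, rfl⟩
    simp
  · rintro rfl
    exact ⟨l.get, List.ofFn_get l⟩

theorem card_stringsOfLength (k : ℕ) : (stringsOfLength k).card = 2 ^ k := by
  rw [stringsOfLength, Finset.card_image_of_injective _ List.ofFn_injective]
  simp

/-- The binary strings of length less than `k`. -/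
def stringsShorterThan (k : ℕ) : Finset (List Bool) :=
  (Finset.range k).biUnion stringsOfLength

theorem mem_stringsShorterThan {k : ℕ} {l : List Bool} :
    l ∈ stringsShorterThan k ↔ l.length < k := by
  simp [stringsShorterThan, mem_stringsOfLength]

theorem card_stringsShorterThan (k : ℕ) : (stringsShorterThan k).card = 2 ^ k - 1 := by
  rw [stringsShorterThan, Finset.card_biUnion]
  · simp only [card_stringsOfLength]
    exact Nat.geomSum_eq le_rfl k |>.trans (by simp)
  · intro i _ j _ hij
    rw [Function.onFun, Finset.disjoint_left]
    intro l hi hj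
    rw [mem_stringsOfLength] at hi hj
    exact hij (hi.symm.trans hj)

theorem exists_injOn_mapsTo_of_card_le {α β : Type*} [Nonempty β] {S : Finset α} {T : Finset β}
    (h : S.card ≤ T.card) : ∃ f : α → β, Set.InjOn f S ∧ ∀ x ∈ S, f x ∈ T := by
  obtain ⟨f, hf, hinj⟩ := S.finite_toSet.exists_injOn_of_encard_le (t := (T : Set β))
    (by simpa only [Set.encard_coe_eq_coe_finsetCard, Nat.cast_le] using h)
  exact ⟨f, hinj, fun x hx => hf hx⟩

theorem exists_fixed_length_code {α : Type*} [Fintype α] {k : ℕ} (h : Fintype.card α ≤ 2 ^ k) :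
    ∃ f : α → List Bool, Function.Injective f ∧ ∀ x, (f x).length = k := by
  obtain ⟨f, hinj, hf⟩ := exists_injOn_mapsTo_of_card_le
    (S := (Finset.univ : Finset α)) (T := stringsOfLength k) (by
      rwa [card_stringsOfLength, Finset.card_univ])
  exact ⟨f, fun x y hxy => hinj (by simp) (by simp) hxy,
    fun x => mem_stringsOfLength.1 (hf x (Finset.mem_univ x))⟩

theorem prefixFree_of_length_eq {α : Type*} {f : α → List Bool} {k : ℕ}
    (hinj : Function.Injective f) (hlen : ∀ x, (f x).length = k) : PrefixFree f :=
  fun x y hxy hpre => hxy (hinj (hpre.eq_of_length ((hlen x).trans (hlen y).symm)))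

theorem PrefixFree.injective {α : Type*} {f : α → List Bool} (hf : PrefixFree f) :
    Function.Injective f := by
  intro x y hxy
  by_contra hne
  exact hf x y hne (hxy ▸ List.prefix_refl _)

theorem exists_injective_code_short_on {α : Type*} [Fintype α] {S : Finset α} {k : ℕ}
    (hS : S.card ≤ 2 ^ k - 1) :
    ∃ f : α → List Bool, Function.Injective f ∧ ∀ x ∈ S, (f x).length < k := by
  classical
  obtain ⟨c, hc, hclen⟩ := exists_fixed_length_code (Nat.lt_two_pow_self (n := Fintype.card α)).le
  obtain ⟨u, hu, huT⟩ :=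
    exists_injOn_mapsTo_of_card_le (hS.trans_eq (card_stringsShorterThan k).symm)
  simp only [mem_stringsShorterThan] at huT
  refine ⟨fun x => if x ∈ S then u x else List.replicate k true ++ c x, ?_, ?_⟩
  · intro x y hxy
    by_cases hx : x ∈ S <;> by_cases hy : y ∈ S <;> simp only [hx, hy, if_true, if_false] at hxy
    · exact hu hx hy hxy
    · have := congrArg List.length hxy
      have := huT x hx
      simp at *
      omega
    · have := congrArg List.length hxy
      have := huT y hy
      simp at *
      omega
    · exact hc (List.append_cancel_left hxy)
  · intro x hx
    simpa [hx] using huT x hx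

theorem exists_prefixFree_code_short_on {α : Type*} [Fintype α] {S : Finset α} {k : ℕ}
    (hS : S.card ≤ 2 ^ k - 1) :
    ∃ f : α → List Bool, PrefixFree f ∧ ∀ x ∈ S, (f x).length = k := by
  classical
  obtain ⟨c, hc, hclen⟩ := exists_fixed_length_code (Nat.lt_two_pow_self (n := Fintype.card α)).le
  have hcard : ((stringsOfLength k).erase (List.replicate k true)).card = 2 ^ k - 1 := by
    rw [Finset.card_erase_of_mem (mem_stringsOfLength.2 (by simp)), card_stringsOfLength]
  obtain ⟨u, hu, huT⟩ := exists_injOn_mapsTo_of_card_le (hS.trans_eq hcard.symm)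
  simp only [Finset.mem_erase, mem_stringsOfLength] at huT
  have hw : (List.replicate k true).length = k := List.length_replicate
  refine ⟨fun x => if x ∈ S then u x else List.replicate k true ++ c x, ?_, ?_⟩
  · intro x y hne hpre
    by_cases hx : x ∈ S <;> by_cases hy : y ∈ S <;> simp only [hx, hy, if_true, if_false] at hpre
    · exact hne (hu hx hy (hpre.eq_of_length ((huT x hx).2.trans (huT y hy).2.symm)))
    · have h := List.prefix_of_prefix_length_le hpre (List.prefix_append _ (c y))
        ((huT x hx).2.trans hw.symm).le
      exact (huT x hx).1 (h.eq_of_length ((huT x hx).2.trans hw.symm))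
    · have h := (List.prefix_append _ (c x)).trans hpre
      exact (huT y hy).1 (h.eq_of_length (hw.trans (huT y hy).2.symm)).symm
    · exact prefixFree_of_length_eq hc hclen x y hne ((List.prefix_append_right_inj _).1 hpre)
  · intro x hx
    simpa [hx] using (huT x hx).2

theorem card_short_codewords_le {α : Type*} [Fintype α] {f : α → List Bool}
    (hf : Function.Injective f) (k : ℕ) :
    (Finset.univ.filter fun x => (f x).length < k).card ≤ 2 ^ k - 1 := by
  rw [← card_stringsShorterThan k]
  exact Finset.card_le_card_of_injOn f
    (fun x hx => by simpa [mem_stringsShorterThan] using hx) hf.injOn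

/-- A set of symbols of which at most one has a codeword longer than `k` has at most `2 ^ k`
elements, since padding and truncating to length `k` keeps the codewords distinct. -/
theorem PrefixFree.card_le_two_pow {α : Type*} {f : α → List Bool} (hf : PrefixFree f) {k : ℕ}
    {S : Finset α} (hS : ∀ x ∈ S, ∀ y ∈ S, x ≠ y → (f x).length ≤ k ∨ (f y).length ≤ k) :
    S.card ≤ 2 ^ k := by
  set h : α → List Bool := fun x => (f x ++ List.replicate k true).take k with hh
  have hlen (x : α) : (h x).length = k := by simp [hh]
  have hshort {x : α} (hx : (f x).length ≤ k) : f x <+: h x :=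
    List.prefix_take_iff.2 ⟨List.prefix_append _ _, hx⟩
  have hlong {x : α} (hx : k ≤ (f x).length) : h x <+: f x := by
    simp only [hh, List.take_append_of_le_length hx]
    exact List.take_prefix _ _
  have key {x y : α} (hxy : h x = h y) (hx : (f x).length ≤ k) : x = y := by
    by_contra hne
    rcases le_total (f y).length k with hy | hy
    · rcases List.prefix_or_prefix_of_prefix (hshort hx) (hxy ▸ hshort hy) with hp | hp
      · exact hf x y hne hp
      · exact hf y x (Ne.symm hne) hp
    · exact hf x y hne ((hshort hx).trans (hxy ▸ hlong hy))
  rw [← card_stringsOfLength k]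
  refine Finset.card_le_card_of_injOn h (fun x _ => mem_stringsOfLength.2 (hlen x)) ?_
  intro x hx y hy hxy
  by_contra hne
  rcases hS x hx y hy hne with h' | h'
  · exact hne (key hxy h')
  · exact hne (key hxy.symm h').symm

theorem PrefixFree.card_short_codewords_lt {α : Type*} [Fintype α] {f : α → List Bool}
    (hf : PrefixFree f) {k : ℕ} (hk : 2 ^ k < Fintype.card α) :
    (Finset.univ.filter fun x => (f x).length ≤ k).card < 2 ^ k := by
  classical
  obtain ⟨z, hz⟩ : ∃ z, ¬ (f z).length ≤ k := by
    by_contra! hall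
    exact hk.not_ge (hf.card_le_two_pow (S := Finset.univ) fun x _ y _ _ => .inl (hall x))
  have hcard := hf.card_le_two_pow (k := k)
    (S := insert z (Finset.univ.filter fun x => (f x).length ≤ k)) (by
      intro x hx y hy hne
      simp only [Finset.mem_insert, Finset.mem_filter, Finset.mem_univ, true_and] at hx hy
      grind)
  rwa [Finset.card_insert_of_notMem (by simpa using hz)] at hcard

theorem epsStar_le {α : Type*} {P : α → ℝ} (hP : ∀ x, 0 ≤ P x) {k : ℕ} {f : α → List Bool}
    (hf : Function.Injective f) : epsStar P k ≤ prob P {x | k ≤ (f x).length} :=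
  csInf_le ⟨0, by rintro _ ⟨g, _, rfl⟩; exact prob_nonneg hP _⟩ ⟨f, hf, rfl⟩

theorem epsPre_le {α : Type*} {P : α → ℝ} (hP : ∀ x, 0 ≤ P x) {k : ℕ} {f : α → List Bool}
    (hf : PrefixFree f) : epsPre P k ≤ prob P {x | k ≤ (f x).length} :=
  csInf_le ⟨0, by rintro _ ⟨g, _, _, rfl⟩; exact prob_nonneg hP _⟩ ⟨f, hf.injective, hf, rfl⟩

theorem epsPre_succ_eq_epsStar {α : Type*} [Fintype α] {P : α → ℝ} (hP : ∀ x, 0 ≤ P x) {k : ℕ}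
    (hk : 2 ^ k < Fintype.card α) : epsPre P (k + 1) = epsStar P k := by
  obtain ⟨c, hc, hclen⟩ := exists_fixed_length_code (Nat.lt_two_pow_self (n := Fintype.card α)).le
  apply le_antisymm
  · refine le_csInf ⟨_, c, hc, rfl⟩ ?_
    rintro _ ⟨f, hf, rfl⟩
    obtain ⟨g, hg, hgS⟩ := exists_prefixFree_code_short_on (card_short_codewords_le hf k)
    refine (epsPre_le hP hg).trans (prob_mono hP fun x hx => ?_)
    simp only [Finset.mem_filter, Finset.mem_univ, true_and] at hgS
    simp only [Set.mem_ofPred_eq] at hx ⊢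
    by_contra! hlt
    have := hgS x hlt
    omega
  · refine le_csInf ⟨_, c, hc, prefixFree_of_length_eq hc hclen, rfl⟩ ?_
    rintro _ ⟨g, _, hg, rfl⟩
    obtain ⟨f, hf, hfS⟩ := exists_injective_code_short_on
      (Nat.le_sub_one_of_lt (hg.card_short_codewords_lt hk))
    refine (epsStar_le hP hf).trans (prob_mono hP fun x hx => ?_)
    simp only [Finset.mem_filter, Finset.mem_univ, true_and] at hfS
    simp only [Set.mem_ofPred_eq] at hx ⊢
    by_contra! hlt
    have := hfS x (Nat.le_of_lt_succ hlt)
    omega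

theorem epsPre_succ_eq_zero {α : Type*} [Fintype α] {P : α → ℝ} (hP : ∀ x, 0 ≤ P x) {k : ℕ}
    (hk : Fintype.card α ≤ 2 ^ k) : epsPre P (k + 1) = 0 := by
  obtain ⟨c, hc, hclen⟩ := exists_fixed_length_code hk
  apply le_antisymm
  · refine (epsPre_le hP (prefixFree_of_length_eq hc hclen)).trans_eq ?_
    simp [prob, hclen]
  · exact Real.sInf_nonneg (by rintro _ ⟨g, _, _, rfl⟩; exact prob_nonneg hP _)

/-- Coupling of the excess-length fundamental limits with and without the prefix
constraint: for every `n ≥ 1` and `k ≥ 1`, `ε_p(n,k+1) = ε*(n,k)` if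
`k < n·log₂|𝒜|`, and `ε_p(n,k+1) = 0` if `k ≥ n·log₂|𝒜|`. -/
theorem epsPre_eq_epsStar
    {𝒜 : Type*} [Fintype 𝒜] (n : ℕ) (hn : 1 ≤ n)
    (P : (Fin n → 𝒜) → ℝ)
    (hpos : ∀ x, 0 < P x) (hP1 : ∑ x, P x = 1)
    (k : ℕ) (hk : 1 ≤ k) :
    ((k : ℝ) < n * Real.logb 2 (Fintype.card 𝒜) → epsPre P (k + 1) = epsStar P k) ∧
    ((n : ℝ) * Real.logb 2 (Fintype.card 𝒜) ≤ (k : ℝ) → epsPre P (k + 1) = 0) := by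
  have : Nonempty 𝒜 := by
    by_contra h
    rw [not_nonempty_iff] at h
    have : IsEmpty (Fin n → 𝒜) := ⟨fun x => h.elim (x ⟨0, hn⟩)⟩
    simp at hP1
  have hcard : (0 : ℝ) < (Fintype.card 𝒜 : ℝ) ^ n := pow_pos (mod_cast Fintype.card_pos) n
  have hlog : (k : ℝ) < n * Real.logb 2 (Fintype.card 𝒜) ↔
      2 ^ k < Fintype.card (Fin n → 𝒜) := by
    rw [← Real.logb_pow, Real.lt_logb_iff_rpow_lt one_lt_two hcard, Real.rpow_natCast]
    simp only [Fintype.card_fun, Fintype.card_fin]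
    norm_cast
  have hP x := (hpos x).le
  refine ⟨fun h => epsPre_succ_eq_epsStar hP (hlog.1 h), fun h => epsPre_succ_eq_zero hP ?_⟩
  exact not_lt.1 (mt hlog.2 h.not_gt)
end

section
/- For any probability mass function P_X on a finite or countably infinite alphabet 𝒳, any optimal compressor f*, and any real a ≥ 0: P[ℓ(f*(X)) ≥ a] ≤ P[ι_X(X) ≥ a], where ι_X(x) = log₂(1/P_X(x)). -/
open scoped BigOperators

/-- The information function `ι_X(x) = log₂(1/P(x))` (in bits). -/
noncomputable def info {α : Type*} (P : α → ℝ) (x : α) : ℝ := Real.logb 2 (1 / P x)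

/-- If the outcomes are ranked by decreasing probability, the outcome of rank `m` has
probability at most `1 / (m + 1)`. -/
theorem rank_add_one_mul_le_one {α : Type*} {P : α → ℝ} (hP0 : ∀ x, 0 ≤ P x)
    (hP : HasSum P 1) {rank : α → ℕ} (hinj : Function.Injective rank)
    (hseg : ∀ x m, m ≤ rank x → ∃ y, rank y = m)
    (hanti : ∀ x y, rank x ≤ rank y → P y ≤ P x) (x : α) :
    ((rank x + 1 : ℕ) : ℝ) * P x ≤ 1 := by
  classical
  set s := (Finset.range (rank x + 1)).preimage rank hinj.injOn with hs
  have hcard : s.card = rank x + 1 := by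
    rw [hs, Finset.card_preimage, Finset.filter_true_of_mem, Finset.card_range]
    intro m hm
    exact hseg x m (Nat.lt_succ_iff.mp (Finset.mem_range.mp hm))
  calc ((rank x + 1 : ℕ) : ℝ) * P x = s.card • P x := by rw [hcard, nsmul_eq_mul]
    _ ≤ ∑ y ∈ s, P y := Finset.card_nsmul_le_sum _ _ _ fun y hy =>
        hanti y x (Nat.lt_succ_iff.mp (Finset.mem_range.mp (Finset.mem_preimage.mp hy)))
    _ ≤ 1 := sum_le_hasSum s (fun y _ => hP0 y) hP

/-- An optimal code assigns to every outcome of positive probability a string no longer than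
its information. -/
theorem IsOptimalCode.length_le_info {α : Type*} {P : α → ℝ} {g : α → List Bool}
    (hg : IsOptimalCode P g) (hP0 : ∀ x, 0 ≤ P x) (hP : HasSum P 1) {x : α} (hx : 0 < P x) :
    ((g x).length : ℝ) ≤ info P x := by
  obtain ⟨-, rank, hinj, hseg, hanti, hlen⟩ := hg
  rw [hlen, info, Real.le_logb_iff_rpow_le one_lt_two (one_div_pos.mpr hx), Real.rpow_natCast]
  calc (2 : ℝ) ^ Nat.log 2 (rank x + 1) ≤ ((rank x + 1 : ℕ) : ℝ) :=
        mod_cast Nat.pow_log_le_self 2 (Nat.succ_ne_zero _)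
    _ ≤ 1 / P x := (le_div_iff₀ hx).mpr (rank_add_one_mul_le_one hP0 hP hinj hseg hanti x)

/-- Achievability bound: for any pmf on a finite or countably infinite alphabet, any optimal
compressor `g`, and any `a ≥ 0`, `P[ℓ(g(X)) ≥ a] ≤ P[ι_X(X) ≥ a]`. -/
theorem optimal_code_length_tail_le_info_tail
    {𝒳 : Type*} [Countable 𝒳] (P : 𝒳 → ℝ)
    (hP0 : ∀ x, 0 ≤ P x) (hP1 : ∑' x, P x = 1)
    (g : 𝒳 → List Bool) (hg : IsOptimalCode P g)
    (a : ℝ) (ha : 0 ≤ a) :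
    prob P {x | a ≤ ((g x).length : ℝ)} ≤ prob P {x | a ≤ info P x} := by
  have hsum : Summable P := by
    by_contra h
    simp [tsum_eq_zero_of_not_summable h] at hP1
  have hP : HasSum P 1 := hP1 ▸ hsum.hasSum
  refine Summable.tsum_le_tsum (fun x => ?_) (hsum.indicator _) (hsum.indicator _)
  rcases (hP0 x).eq_or_lt with hx | hx
  · simp [Set.indicator_apply, ← hx]
  · by_cases hax : x ∈ {x | a ≤ ((g x).length : ℝ)}
    · rw [Set.indicator_of_mem hax,
        Set.indicator_of_mem (show x ∈ {x | a ≤ info P x} from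
          le_trans hax (hg.length_le_info hP0 hP hx))]
    · rw [Set.indicator_of_notMem hax]
      exact Set.indicator_nonneg (fun y _ => hP0 y) x
end

section
/- For any probability mass function P_X on a finite alphabet 𝒳, any optimal compressor f*, and any nonnegative integer k: sup over τ > 0 of ( P[ι_X(X) ≥ k + τ] − 2^{−τ} ) ≤ P[ℓ(f*(X)) ≥ k], where ι_X(x) = log₂(1/P_X(x)). -/
open scoped BigOperators

/-- If the information of `x` is at least `a`, then `P x ≤ 2 ^ (-a)`. -/
theorem le_rpow_neg_of_le_info {α : Type*} {P : α → ℝ} {x : α} (hP : 0 ≤ P x) {a : ℝ}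
    (h : a ≤ info P x) : P x ≤ (2 : ℝ) ^ (-a) := by
  rcases hP.eq_or_lt with h0 | hpos
  · rw [← h0]
    positivity
  · rw [info, one_div, Real.logb_inv] at h
    rw [← Real.logb_le_iff_le_rpow one_lt_two hpos]
    linarith

/-- At most `n` elements have injectively assigned rank below `n`. -/
theorem card_filter_lt_le_of_injective {α : Type*} [Fintype α] {r : α → ℕ}
    (hr : Function.Injective r) (n : ℕ) : (Finset.univ.filter fun x => r x < n).card ≤ n := by
  have h := Finset.card_le_card_of_injOn (s := Finset.univ.filter fun x => r x < n)
    (t := Finset.range n) r (fun x hx => by simpa using hx) hr.injOn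
  simpa using h

/-- Converse bound: for any optimal compressor `g` and nonnegative integer `k`,
`P[ι_X(X) ≥ k + τ] − 2^{−τ} ≤ P[ℓ(g(X)) ≥ k]` for every `τ > 0`
(equivalently, the supremum over `τ > 0` of the left side is at most the right side). -/
theorem info_tail_sub_le_optimal_length_tail
    {𝒳 : Type*} [Fintype 𝒳] (P : 𝒳 → ℝ)
    (hP0 : ∀ x, 0 ≤ P x) (hP1 : ∑ x, P x = 1)
    (g : 𝒳 → List Bool) (hg : IsOptimalCode P g)
    (k : ℕ) :
    ∀ τ : ℝ, 0 < τ →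
      prob P {x | (k : ℝ) + τ ≤ info P x} - (2 : ℝ) ^ (-τ) ≤
        prob P {x | k ≤ (g x).length} := by
  intro τ hτ
  obtain ⟨-, rank, hinj, -, -, hlen⟩ := hg
  simp only [prob, tsum_fintype]
  set c : ℝ := (2 : ℝ) ^ (-((k : ℝ) + τ)) with hc
  have hc0 : 0 ≤ c := by positivity
  have hpt : ∀ x, ({x | (k : ℝ) + τ ≤ info P x} : Set 𝒳).indicator P x ≤
      ({x | k ≤ (g x).length} : Set 𝒳).indicator P x + if rank x < 2 ^ k then c else 0 := by
    intro x
    have hite : 0 ≤ if rank x < 2 ^ k then c else 0 := by split_ifs <;> simp [hc0]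
    by_cases hB : k ≤ (g x).length
    · rw [Set.indicator_of_mem (s := {x | k ≤ (g x).length}) hB]
      have := Set.indicator_le_self' (s := {x | (k : ℝ) + τ ≤ info P x}) (fun y _ => hP0 y) x
      linarith
    · rw [Set.indicator_of_notMem (s := {x | k ≤ (g x).length}) hB, zero_add]
      rw [hlen, not_le] at hB
      have hrank : rank x < 2 ^ k :=
        (Nat.lt_succ_self _).trans (Nat.lt_pow_of_log_lt one_lt_two hB)
      rw [if_pos hrank]
      exact Set.indicator_apply_le' (fun hA => le_rpow_neg_of_le_info (hP0 x) hA) fun _ => hc0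
  have hsum := Finset.sum_le_sum fun x (_ : x ∈ Finset.univ) => hpt x
  rw [Finset.sum_add_distrib, ← Finset.sum_filter, Finset.sum_const, nsmul_eq_mul] at hsum
  have hcard : ((Finset.univ.filter fun x => rank x < 2 ^ k).card : ℝ) ≤ 2 ^ k := by
    exact_mod_cast card_filter_lt_le_of_injective hinj (2 ^ k)
  have hmul : (2 : ℝ) ^ k * c = (2 : ℝ) ^ (-τ) := by
    rw [hc, ← Real.rpow_natCast, ← Real.rpow_add two_pos]
    congr 1
    ring
  have := mul_le_mul_of_nonneg_right hcard hc0
  linarith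
end

section
/- For any probability mass function P_X on a finite alphabet 𝒳, any injective compressor f: 𝒳 → {0,1}*, and any τ > 0: P[ℓ(f(X)) ≤ ι_X(X) − τ] ≤ 2^{−τ}·(⌊log₂|𝒳|⌋ + 1), where ι_X(x) = log₂(1/P_X(x)). -/
open scoped BigOperators

/-- An injective code has at most `2 ^ k` codewords of length `k`. -/
theorem card_length_eq_le_two_pow {α : Type*} [Fintype α] (f : α → List Bool)
    (hf : Function.Injective f) (k : ℕ) :
    (Finset.univ.filter fun x => (f x).length = k).card ≤ 2 ^ k := by
  let g : {x // (f x).length = k} → List.Vector Bool k := fun x => ⟨f x.1, x.2⟩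
  have hinj : Function.Injective g :=
    fun x y h => Subtype.ext (hf (congrArg Subtype.val h))
  have h := Fintype.card_le_of_injective _ hinj
  rwa [Fintype.card_subtype, card_vector, Fintype.card_bool] at h

/-- A Kraft-type inequality for injective codes: the Kraft sum is at most `L + 1` as soon as there
are fewer than `2 ^ (L + 1)` codewords. -/
theorem sum_half_pow_length_le {α : Type*} [Fintype α] (f : α → List Bool)
    (hf : Function.Injective f) (L : ℕ) (hL : Fintype.card α < 2 ^ (L + 1)) :
    ∑ x, (1 / 2 : ℝ) ^ (f x).length ≤ (L : ℝ) + 1 := by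
  set c : ℝ := (1 / 2) ^ L with hc
  have hc0 : 0 < c := by positivity
  have hexcess : ∑ x ∈ Finset.univ.filter (fun x => (f x).length ∈ Finset.range (L + 1)),
      ((1 / 2 : ℝ) ^ (f x).length - c) ≤ ∑ k ∈ Finset.range (L + 1), (1 - 2 ^ k * c) := by
    rw [← Finset.sum_fiberwise_of_maps_to (t := Finset.range (L + 1))
      (g := fun x => (f x).length) (fun x hx => (Finset.mem_filter.1 hx).2)]
    refine Finset.sum_le_sum fun k hk => ?_
    have hkL : c ≤ (1 / 2 : ℝ) ^ k :=
      pow_le_pow_of_le_one (by norm_num) (by norm_num) (Nat.lt_succ_iff.1 (Finset.mem_range.1 hk))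
    have hcard : (((Finset.univ.filter fun x => (f x).length ∈ Finset.range (L + 1)).filter
        fun x => (f x).length = k).card : ℝ) ≤ 2 ^ k := by
      exact_mod_cast (Finset.card_le_card
        (Finset.filter_subset_filter _ (Finset.filter_subset _ _))).trans
        (card_length_eq_le_two_pow f hf k)
    have hone : (2 : ℝ) ^ k * (1 / 2) ^ k = 1 := by rw [← mul_pow]; norm_num
    rw [Finset.sum_congr rfl (g := fun _ => (1 / 2 : ℝ) ^ k - c)
      (fun x hx => by rw [(Finset.mem_filter.1 hx).2]), Finset.sum_const, nsmul_eq_mul]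
    calc _ ≤ (2 : ℝ) ^ k * ((1 / 2) ^ k - c) :=
          mul_le_mul_of_nonneg_right hcard (sub_nonneg.2 hkL)
      _ = 1 - 2 ^ k * c := by rw [mul_sub, hone]
  have hsplit : ∑ x, (1 / 2 : ℝ) ^ (f x).length ≤ (Fintype.card α : ℝ) * c +
      ∑ x ∈ Finset.univ.filter (fun x => (f x).length ∈ Finset.range (L + 1)),
        ((1 / 2 : ℝ) ^ (f x).length - c) := by
    rw [Finset.sum_filter, ← nsmul_eq_mul, ← Finset.card_univ, ← Finset.sum_const,
      ← Finset.sum_add_distrib]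
    refine Finset.sum_le_sum fun x _ => ?_
    split_ifs with h
    · linarith
    · rw [add_zero]
      refine pow_le_pow_of_le_one (by norm_num) (by norm_num) ?_
      rw [Finset.mem_range] at h
      omega
  have hgeom : ∑ k ∈ Finset.range (L + 1), (1 - (2 : ℝ) ^ k * c) =
      (L : ℝ) + 1 - (2 ^ (L + 1) - 1) * c := by
    rw [Finset.sum_sub_distrib, ← Finset.sum_mul, geom_sum_eq (by norm_num)]
    norm_num
  have hN : (Fintype.card α : ℝ) ≤ 2 ^ (L + 1) - 1 := by
    have : (Fintype.card α : ℝ) + 1 ≤ 2 ^ (L + 1) := by exact_mod_cast hL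
    linarith
  linarith [mul_le_mul_of_nonneg_right hN hc0.le]

/-- A letter whose information exceeds `n` bits by at least `τ` has probability at most
`2 ^ (-τ) * 2 ^ (-n)`. -/
theorem le_of_natCast_le_info_sub {α : Type*} (P : α → ℝ) (x : α) (hx : 0 ≤ P x) (n : ℕ) (τ : ℝ)
    (h : (n : ℝ) ≤ info P x - τ) : P x ≤ (2 : ℝ) ^ (-τ) * (1 / 2) ^ n := by
  rcases hx.eq_or_lt with h0 | hpos
  · rw [← h0]
    positivity
  · have hlog : Real.logb 2 (P x) ≤ -τ + -(n : ℝ) := by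
      rw [info, one_div, Real.logb_inv] at h
      linarith
    rw [Real.logb_le_iff_le_rpow (by norm_num) hpos, Real.rpow_add (by norm_num),
      Real.rpow_neg (by norm_num) (n : ℝ), Real.rpow_natCast] at hlog
    rwa [one_div, inv_pow]

/-- Converse for arbitrary (not necessarily prefix) compressors: for any injective
`f : 𝒳 → {0,1}*` and `τ > 0`,
`P[ℓ(f(X)) ≤ ι_X(X) − τ] ≤ 2^{−τ}·(⌊log₂ |𝒳|⌋ + 1)`. -/
theorem length_below_info_prob_le
    {𝒳 : Type*} [Fintype 𝒳] (P : 𝒳 → ℝ)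
    (hP0 : ∀ x, 0 ≤ P x) (hP1 : ∑ x, P x = 1)
    (f : 𝒳 → List Bool) (hf : Function.Injective f)
    (τ : ℝ) (hτ : 0 < τ) :
    prob P {x | ((f x).length : ℝ) ≤ info P x - τ} ≤
      (2 : ℝ) ^ (-τ) * ((Nat.log 2 (Fintype.card 𝒳) : ℝ) + 1) := by
  calc prob P {x | ((f x).length : ℝ) ≤ info P x - τ}
      = ∑ x, Set.indicator {x | ((f x).length : ℝ) ≤ info P x - τ} P x := tsum_fintype _
    _ ≤ ∑ x, (2 : ℝ) ^ (-τ) * (1 / 2) ^ (f x).length :=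
        Finset.sum_le_sum fun x _ => Set.indicator_apply_le'
          (fun hx => le_of_natCast_le_info_sub P x (hP0 x) _ τ hx) (fun _ => by positivity)
    _ = (2 : ℝ) ^ (-τ) * ∑ x, (1 / 2 : ℝ) ^ (f x).length := (Finset.mul_sum _ _ _).symm
    _ ≤ (2 : ℝ) ^ (-τ) * ((Nat.log 2 (Fintype.card 𝒳) : ℝ) + 1) :=
        mul_le_mul_of_nonneg_left
          (sum_half_pow_length_le f hf _ (Nat.lt_pow_succ_log_self (by norm_num) _))
          (by positivity)
end

section
/- Let P_X be a probability mass function on a finite alphabet 𝒳 and let N ≥ 1. Consider a random binning compressor f: 𝒳 → {1,…,N} chosen uniformly at random among all such (not necessarily injective) maps, with each bin assignment independent, and a decompressor that outputs the most likely source outcome in the received bin, breaking ties uniformly at random. Then the expected probability of incorrect decoding equals 1 − E[ Σ_{ℓ=0}^{J(X)−1} binom(J(X)−1, ℓ) · N^{−ℓ} (1+ℓ)^{−1} · (1 − 1/N)^{M(1/P_X(X)) + J(X) − ℓ − 1} ], where M(β) is the number of outcomes with probability strictly greater than 1/β and J(x) = P[P_X(X) = P_X(x)] / P_X(x) is the number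 of outcomes with the same probability as x. -/
open scoped BigOperators

/-- Number of masses with probability strictly greater than that of `x`
(this is `M(1/P_X(x))` in the paper's notation). -/
noncomputable def McntAt {α : Type*} (P : α → ℝ) (x : α) : ℕ :=
  Set.ncard {y | P x < P y}

/-- `J(x)`: number of masses whose probability equals that of `x`. -/
noncomputable def Jcnt {α : Type*} (P : α → ℝ) (x : α) : ℕ :=
  Set.ncard {y | P y = P x}

/-- Probability of correct decoding of the realization `x` for a fixed binning compressor
`f`, when the decompressor outputs the most likely outcome in the bin `f x`, breaking ties
uniformly at random: it is `0` if some strictly more likely outcome shares the bin, and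
`1/(1+ℓ)` where `ℓ` is the number of other equally likely outcomes in the bin otherwise. -/
noncomputable def pCorrect {α : Type*} (P : α → ℝ) {N : ℕ}
    (f : α → Fin N) (x : α) : ℝ := by
  classical
  exact if (∃ y, y ≠ x ∧ f y = f x ∧ P x < P y) then 0
    else 1 / (1 + (Set.ncard {y | y ≠ x ∧ f y = f x ∧ P y = P x} : ℝ))

open Finset in
/-- Under uniform random binning, the probability that every element of `A` and no element of `B`
falls into the given bin `b`. -/
theorem card_binning_prescribed_bin {α : Type*} [Fintype α] [DecidableEq α] {N : ℕ} (hN : 1 ≤ N)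
    {A B : Finset α} (hAB : Disjoint A B) (b : Fin N) :
    (#{f : α → Fin N | (∀ y ∈ A, f y = b) ∧ ∀ y ∈ B, f y ≠ b} : ℝ) / (N : ℝ) ^ Fintype.card α
      = (1 / (N : ℝ)) ^ #A * (1 - 1 / (N : ℝ)) ^ #B := by
  have hN0 : (N : ℝ) ≠ 0 := by positivity
  have hpi : ({f : α → Fin N | (∀ y ∈ A, f y = b) ∧ ∀ y ∈ B, f y ≠ b} : Finset (α → Fin N))
      = Fintype.piFinset fun y => if y ∈ A then {b} else if y ∈ B then {b}ᶜ else univ := by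
    ext f
    simp only [mem_filter, mem_univ, true_and, Fintype.mem_piFinset]
    constructor
    · rintro ⟨hA, hB⟩ y
      split_ifs with h h'
      · simpa using hA y h
      · simpa using hB y h'
      · simp
    · intro h
      refine ⟨fun y hy => by simpa [hy] using h y, fun y hy => ?_⟩
      simpa [hy, disjoint_right.1 hAB hy] using h y
  rw [hpi, Fintype.card_piFinset, ← card_univ, ← prod_const, Nat.cast_prod, ← prod_div_distrib]
  have hfac : ∀ y : α,
      ((#(if y ∈ A then {b} else if y ∈ B then {b}ᶜ else univ : Finset (Fin N)) : ℕ) : ℝ) / N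
        = (if y ∈ A then 1 / (N : ℝ) else 1) * (if y ∈ B then 1 - 1 / (N : ℝ) else 1) := by
    intro y
    by_cases hA : y ∈ A
    · simp [hA, disjoint_left.1 hAB hA]
    · by_cases hB : y ∈ B
      · simp [hA, hB, card_compl, Nat.cast_sub hN]
        field_simp
      · simp [hA, hB, hN0]
  simp_rw [hfac]
  rw [prod_mul_distrib]
  simp [prod_ite_mem]

open Finset in
/-- Under uniform random binning, the probability that every element of `S` and no element of `B`
shares the bin of `x`. -/
theorem card_binning_shared_bin {α : Type*} [Fintype α] [DecidableEq α] {N : ℕ} (hN : 1 ≤ N)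
    {x : α} {S B : Finset α} (hSB : Disjoint S B) (hxS : x ∉ S) (hxB : x ∉ B) :
    (#{f : α → Fin N | (∀ y ∈ S, f y = f x) ∧ ∀ y ∈ B, f y ≠ f x} : ℝ)
        / (N : ℝ) ^ Fintype.card α
      = (1 / (N : ℝ)) ^ #S * (1 - 1 / (N : ℝ)) ^ #B := by
  have hN0 : (N : ℝ) ≠ 0 := by positivity
  have hfib : ∀ b : Fin N,
      filter (fun f => f x = b)
          ({f : α → Fin N | (∀ y ∈ S, f y = f x) ∧ ∀ y ∈ B, f y ≠ f x} : Finset (α → Fin N))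
        = ({f : α → Fin N | (∀ y ∈ insert x S, f y = b) ∧ ∀ y ∈ B, f y ≠ b} :
            Finset (α → Fin N)) := by
    intro b
    ext f
    simp only [mem_filter, mem_univ, true_and, forall_mem_insert]
    constructor
    · rintro ⟨h, rfl⟩
      exact ⟨⟨rfl, h.1⟩, h.2⟩
    · rintro ⟨⟨rfl, h⟩, h'⟩
      exact ⟨⟨h, h'⟩, rfl⟩
  rw [card_eq_sum_card_fiberwise (f := fun f : α → Fin N => f x) (t := univ)
    (fun _ _ => by simp), Nat.cast_sum, sum_div]
  simp_rw [hfib, card_binning_prescribed_bin hN (disjoint_insert_left.2 ⟨hxB, hSB⟩)]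
  simp only [sum_const, card_univ, Fintype.card_fin, nsmul_eq_mul, card_insert_of_notMem hxS]
  rw [pow_succ]
  field_simp

open Finset in
/-- The probability of correct decoding, split according to the set of equally likely outcomes
sharing the bin of `x`. -/
theorem pCorrect_eq_sum_powerset {α : Type*} [Fintype α] [DecidableEq α] (P : α → ℝ) {N : ℕ}
    (f : α → Fin N) (x : α) {T M : Finset α} (hT : ∀ y, y ∈ T ↔ y ≠ x ∧ P y = P x)
    (hM : ∀ y, y ∈ M ↔ P x < P y) :
    pCorrect P f x = ∑ S ∈ T.powerset,
      if (∀ y ∈ S, f y = f x) ∧ ∀ y ∈ T \ S ∪ M, f y ≠ f x then 1 / (1 + (#S : ℝ)) else 0 := by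
  unfold pCorrect
  split_ifs with h
  · obtain ⟨y, -, hy, hlt⟩ := h
    refine (sum_eq_zero fun S _ => if_neg fun hS => ?_).symm
    exact hS.2 y (mem_union_right _ ((hM y).2 hlt)) hy
  · have hset : {y | y ≠ x ∧ f y = f x ∧ P y = P x}
        = (T.filter (fun y => f y = f x) : Set α) := by
      ext y
      simp only [Set.mem_ofPred_eq, coe_filter, hT]
      tauto
    rw [hset, Set.ncard_coe_finset, sum_eq_single_of_mem (T.filter fun y => f y = f x)
      (mem_powerset.2 (filter_subset _ _)), if_pos]
    · refine ⟨fun y hy => (mem_filter.1 hy).2, fun y hy hfy => ?_⟩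
      rcases mem_union.1 hy with hy | hy
      · rw [mem_sdiff, mem_filter] at hy
        exact hy.2 ⟨hy.1, hfy⟩
      · have hlt := (hM y).1 hy
        exact h ⟨y, fun hyx => (hyx ▸ hlt).false, hfy, hlt⟩
    · intro S hS hne
      refine if_neg fun hS' => hne ?_
      ext y
      rw [mem_filter]
      refine ⟨fun hy => ⟨mem_powerset.1 hS hy, hS'.1 y hy⟩, fun hy => ?_⟩
      by_contra hyS
      exact hS'.2 y (mem_union_left _ (mem_sdiff.2 ⟨hy.1, hyS⟩)) hy.2

open Finset in
/-- The probability of correct decoding of `x`, averaged over all binning compressors. -/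
theorem sum_pCorrect_div {α : Type*} [Fintype α] [DecidableEq α] (P : α → ℝ) {N : ℕ}
    (hN : 1 ≤ N) (x : α) :
    (∑ f : α → Fin N, pCorrect P f x) / (N : ℝ) ^ Fintype.card α
      = ∑ l ∈ range (Jcnt P x),
          ((Jcnt P x - 1).choose l : ℝ) / ((N : ℝ) ^ l * (1 + (l : ℝ)))
            * (1 - 1 / (N : ℝ)) ^ (McntAt P x + (Jcnt P x - 1 - l)) := by
  set T : Finset α := {y | y ≠ x ∧ P y = P x} with hTdef
  set M : Finset α := {y | P x < P y} with hMdef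
  have hT : ∀ y, y ∈ T ↔ y ≠ x ∧ P y = P x := by simp [hTdef]
  have hM : ∀ y, y ∈ M ↔ P x < P y := by simp [hMdef]
  have hxT : x ∉ T := by simp [hT]
  have hJ : Jcnt P x = #T + 1 := by
    rw [Jcnt, ← card_insert_of_notMem hxT, ← Set.ncard_coe_finset]
    congr 1
    ext y
    by_cases hy : y = x <;> simp [hT, hy]
  have hMc : McntAt P x = #M := by
    rw [McntAt, ← Set.ncard_coe_finset]
    congr 1
    ext y
    simp [hM]
  have hTM : Disjoint T M := disjoint_left.2 fun y hy hy' =>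
    (((hT y).1 hy).2 ▸ (hM y).1 hy').false
  have hterm : ∀ S ∈ T.powerset,
      (∑ f : α → Fin N,
        if (∀ y ∈ S, f y = f x) ∧ ∀ y ∈ T \ S ∪ M, f y ≠ f x then 1 / (1 + (#S : ℝ)) else 0)
          / (N : ℝ) ^ Fintype.card α
        = 1 / ((N : ℝ) ^ #S * (1 + (#S : ℝ))) * (1 - 1 / (N : ℝ)) ^ (#M + (#T - #S)) := by
    intro S hS
    have hST := mem_powerset.1 hS
    have hdisj : Disjoint S (T \ S ∪ M) :=
      disjoint_union_right.2 ⟨disjoint_sdiff, hTM.mono_left hST⟩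
    have hxB : x ∉ T \ S ∪ M := by simp [hT, hM]
    have hcard : #(T \ S ∪ M) = #M + (#T - #S) := by
      rw [card_union_of_disjoint (hTM.mono_left sdiff_subset), card_sdiff_of_subset hST, add_comm]
    rw [← sum_filter, sum_const, nsmul_eq_mul, mul_div_right_comm,
      card_binning_shared_bin hN hdisj (fun h => hxT (hST h)) hxB, hcard]
    simp only [one_div, inv_pow, mul_inv]
    ring
  simp_rw [pCorrect_eq_sum_powerset P _ x hT hM]
  rw [sum_comm, sum_div, sum_congr rfl hterm,
    sum_powerset_apply_card (fun l : ℕ => 1 / ((N : ℝ) ^ l * (1 + (l : ℝ)))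
      * (1 - 1 / (N : ℝ)) ^ (#M + (#T - l))), hJ, hMc]
  refine sum_congr rfl fun l _ => ?_
  rw [nsmul_eq_mul, Nat.add_sub_cancel]
  ring

/-- Exact behavior of random binning: averaging uniformly over all binning compressors
`f : 𝒳 → {1,…,N}`, the expected probability of incorrect decoding equals
`1 − E[ Σ_{ℓ=0}^{J(X)−1} C(J(X)−1,ℓ) · N^{−ℓ}(1+ℓ)^{−1} · (1−1/N)^{M(1/P_X(X))+J(X)−ℓ−1} ]`. -/
theorem random_binning_exact_error
    {𝒳 : Type*} [Fintype 𝒳] [DecidableEq 𝒳] (P : 𝒳 → ℝ)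
    (hP0 : ∀ x, 0 ≤ P x) (hP1 : ∑ x, P x = 1)
    (N : ℕ) (hN : 1 ≤ N) :
    (∑ f : 𝒳 → Fin N, ∑ x, P x * (1 - pCorrect P f x)) / ((N : ℝ) ^ Fintype.card 𝒳)
      = 1 - ∑ x, P x *
          ∑ l ∈ Finset.range (Jcnt P x),
            ((Jcnt P x - 1).choose l : ℝ) / ((N : ℝ) ^ l * (1 + (l : ℝ)))
              * (1 - 1 / (N : ℝ)) ^ (McntAt P x + (Jcnt P x - 1 - l)) := by
  have hN0 : (N : ℝ) ≠ 0 := by positivity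
  simp_rw [← sum_pCorrect_div P hN, mul_sub, mul_one, Finset.sum_sub_distrib, hP1]
  rw [Finset.sum_comm, sub_div]
  congr 1
  · simp [hN0]
  · simp_rw [← Finset.mul_sum, Finset.sum_div, mul_div_assoc, Finset.sum_div]
end

section
/- Let X_M be uniformly distributed on a set of M elements. Then the expected optimal codelength equals E[ℓ(f*(X_M))] = ⌊log₂ M⌋ + (1/M)·(2 + ⌊log₂ M⌋ − 2^{⌊log₂ M⌋+1}), which simplifies to ((M+1)·log₂(M+1))/M − 2 when M+1 is a power of 2. Consequently, with the entropy H(X_M) = log₂ M in bits, limsup_{M→∞} ( H(X_M) − E[ℓ(f*(X_M))] ) = 2 and liminf_{M→∞} ( H(X_M) − E[ℓ(f*(X_M))] ) = 1 + log₂ e − log₂ log₂ e. -/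
open scoped BigOperators
open Filter

/-- If the values of `u` are eventually below every `b > a` and `u` tends to `a` along a
subsequence, then its upper limit is `a`. -/
lemma limsup_eq_of_tendsto_comp {u : ℕ → ℝ} {a : ℝ} {φ : ℕ → ℕ} (hφ : Tendsto φ atTop atTop)
    (hsub : Tendsto (fun n => u (φ n)) atTop (nhds a))
    (hu : ∀ b, a < b → ∀ᶠ n in atTop, u n ≤ b) : limsup u atTop = a := by
  have hfreq : ∀ b, b < a → ∃ᶠ n in atTop, b ≤ u n := fun b hb =>
    hφ.frequently (hsub.eventually (eventually_ge_nhds hb)).frequently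
  apply le_antisymm
  · exact le_of_forall_gt_imp_ge_of_dense fun b hb => limsup_le_of_le
      (IsCoboundedUnder.of_frequently_ge (hfreq (a - 1) (by linarith))) (hu b hb)
  · exact le_of_forall_lt_imp_le_of_dense fun b hb => le_limsup_of_frequently_le (hfreq b hb)
      ⟨a + 1, eventually_map.2 (hu (a + 1) (by linarith))⟩

/-- If the values of `u` are eventually above every `b < a` and `u` tends to `a` along a
subsequence, then its lower limit is `a`. -/
lemma liminf_eq_of_tendsto_comp {u : ℕ → ℝ} {a : ℝ} {φ : ℕ → ℕ} (hφ : Tendsto φ atTop atTop)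
    (hsub : Tendsto (fun n => u (φ n)) atTop (nhds a))
    (hu : ∀ b, b < a → ∀ᶠ n in atTop, b ≤ u n) : liminf u atTop = a := by
  have hfreq : ∀ b, a < b → ∃ᶠ n in atTop, u n ≤ b := fun b hb =>
    hφ.frequently (hsub.eventually (eventually_le_nhds hb)).frequently
  apply le_antisymm
  · exact le_of_forall_gt_imp_ge_of_dense fun b hb => liminf_le_of_frequently_le (hfreq b hb)
      ⟨a - 1, eventually_map.2 (hu (a - 1) (by linarith))⟩
  · exact le_of_forall_lt_imp_le_of_dense fun b hb => le_liminf_of_le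
      (IsCoboundedUnder.of_frequently_le (hfreq (a + 1) (by linarith))) (hu b hb)

lemma sum_range_log_two_succ (M : ℕ) :
    ∑ i ∈ Finset.range M, Nat.log 2 (i + 1) + 2 ^ (Nat.log 2 M + 1) =
      (M + 1) * Nat.log 2 M + 2 := by
  induction M with
  | zero => simp
  | succ M ih =>
    rw [Finset.sum_range_succ]
    rcases Nat.eq_zero_or_pos M with rfl | hM
    · simp
    have hlow : 2 ^ Nat.log 2 M ≤ M := Nat.pow_log_le_self 2 hM.ne'
    have hup : M < 2 ^ (Nat.log 2 M + 1) := Nat.lt_pow_succ_log_self one_lt_two M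
    set n := Nat.log 2 M
    rcases (Nat.succ_le_of_lt hup).lt_or_eq with h | h
    · have hn : Nat.log 2 (M + 1) = n :=
        (Nat.log_eq_iff (Or.inr ⟨one_lt_two, by omega⟩)).2 ⟨by omega, h⟩
      rw [hn]
      linarith
    · have h' : M + 1 = 2 ^ (n + 1) := h
      have hn : Nat.log 2 (M + 1) = n + 1 := by rw [h', Nat.log_pow one_lt_two]
      rw [hn, pow_succ 2 (n + 1), ← h']
      rw [← h'] at ih
      linarith

/-- The function `x ↦ log₂ x + 2 / x` governing the gap between entropy and codelength. -/
noncomputable def dyadicGap (x : ℝ) : ℝ := Real.logb 2 x + 2 / x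

lemma continuousAt_dyadicGap {x : ℝ} (hx : 0 < x) : ContinuousAt dyadicGap x :=
  (Real.continuousAt_logb hx.ne').add (continuousAt_const.div continuousAt_id hx.ne')

lemma dyadicGap_le_two {x : ℝ} (h1 : 1 ≤ x) (h2 : x ≤ 2) : dyadicGap x ≤ 2 := by
  have hx : 0 < x := by linarith
  have hl : 0 < Real.log 2 := Real.log_pos one_lt_two
  have h1' : 0 ≤ 2 / x - 1 := by rw [sub_nonneg, le_div_iff₀ hx]; linarith
  have h2' : 0 ≤ 2 - 2 / x := by rw [sub_nonneg, div_le_iff₀ hx]; linarith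
  have hmem := strictConcaveOn_log_Ioi.concaveOn.2 (Set.mem_Ioi.2 (one_pos (α := ℝ)))
    (Set.mem_Ioi.2 (one_half_pos (α := ℝ))) h1' h2' (by ring)
  simp only [smul_eq_mul, Real.log_one, mul_zero, zero_add] at hmem
  rw [show (2 / x - 1) * 1 + (2 - 2 / x) * (1 / 2) = x⁻¹ by ring, Real.log_inv, one_div,
    Real.log_inv] at hmem
  have : Real.logb 2 x ≤ 2 - 2 / x := by
    rw [Real.logb, div_le_iff₀ hl]
    linarith
  unfold dyadicGap
  linarith

lemma dyadicGap_two_mul_log_two : dyadicGap (2 * Real.log 2) =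
    1 + Real.logb 2 (Real.exp 1) - Real.logb 2 (Real.logb 2 (Real.exp 1)) := by
  have hl : 0 < Real.log 2 := Real.log_pos one_lt_two
  have he : Real.logb 2 (Real.exp 1) = (Real.log 2)⁻¹ := by simp [Real.logb]
  rw [dyadicGap, he, Real.logb_inv, Real.logb_mul two_ne_zero hl.ne',
    Real.logb_self_eq_one one_lt_two]
  field_simp
  ring

lemma dyadicGap_two_mul_log_two_le {x : ℝ} (hx : 0 < x) :
    dyadicGap (2 * Real.log 2) ≤ dyadicGap x := by
  have hl : 0 < Real.log 2 := Real.log_pos one_lt_two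
  have hc : 0 < 2 * Real.log 2 := by positivity
  have h := Real.one_sub_inv_le_log_of_pos (div_pos hx hc)
  rw [Real.log_div hx.ne' hc.ne', inv_div] at h
  have h' := div_le_div_of_nonneg_right h hl.le
  have e1 : (1 - 2 * Real.log 2 / x) / Real.log 2 = 2 / (2 * Real.log 2) - 2 / x := by
    field_simp
  rw [e1, sub_div] at h'
  unfold dyadicGap Real.logb
  linarith

/-- The entropy gap is `dyadicGap` of the mantissa of `M`, up to a vanishing error. -/
lemma logb_sub_eq_dyadicGap_sub {M : ℕ} (hM : 1 ≤ M) :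
    Real.logb 2 M - ((Nat.log 2 M : ℝ) +
      (1 / (M : ℝ)) * (2 + (Nat.log 2 M : ℝ) - (2 : ℝ) ^ (Nat.log 2 M + 1))) =
    dyadicGap (M / 2 ^ Nat.log 2 M) - (2 + (Nat.log 2 M : ℝ)) / M := by
  have hM' : (M : ℝ) ≠ 0 := by positivity
  rw [dyadicGap, Real.logb_div hM' (by positivity), Real.logb_pow,
    Real.logb_self_eq_one one_lt_two]
  field_simp
  ring

lemma tendsto_two_add_log_two_div_atTop :
    Tendsto (fun M : ℕ => (2 + (Nat.log 2 M : ℝ)) / M) atTop (nhds 0) := by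
  have hlog : Tendsto (Nat.log 2) atTop atTop :=
    tendsto_atTop.2 fun b => (eventually_ge_atTop (2 ^ b)).mono fun M hM =>
      Nat.le_log_of_pow_le one_lt_two hM
  have h1 : Tendsto (fun n : ℕ => (2 + (n : ℝ)) / 2 ^ n) atTop (nhds 0) := by
    have ha : Tendsto (fun n : ℕ => (2 : ℝ) * (1 / 2) ^ n) atTop (nhds (2 * 0)) :=
      (tendsto_pow_atTop_nhds_zero_of_lt_one (by norm_num) (by norm_num)).const_mul 2
    have hb := tendsto_self_mul_const_pow_of_lt_one (r := (1 / 2 : ℝ)) (by norm_num) (by norm_num)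
    have hab := ha.add hb
    rw [mul_zero, add_zero] at hab
    refine hab.congr fun n => ?_
    rw [one_div, inv_pow]
    ring
  refine tendsto_of_tendsto_of_tendsto_of_le_of_le' tendsto_const_nhds (h1.comp hlog)
    (Eventually.of_forall fun M => by positivity) ?_
  filter_upwards [eventually_ge_atTop 1] with M hM
  have h : ((2 ^ Nat.log 2 M : ℕ) : ℝ) ≤ M := Nat.cast_le.2 (Nat.pow_log_le_self 2 (by omega))
  push_cast at h
  exact div_le_div_of_nonneg_left (by positivity) (by positivity) h

lemma one_le_two_mul_log_two : 1 ≤ 2 * Real.log 2 := by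
  linarith [Real.log_two_gt_d9]

/-- The integers `⌊x 2 ^ n⌋` with `1 ≤ x < 2` have exactly `n + 1` binary digits. -/
lemma log_two_floor_mul_two_pow {x : ℝ} (h1 : 1 ≤ x) (h2 : x < 2) (n : ℕ) :
    Nat.log 2 ⌊x * 2 ^ n⌋₊ = n := by
  have hp : (0 : ℝ) < 2 ^ n := by positivity
  have hlow : 2 ^ n ≤ ⌊x * 2 ^ n⌋₊ := Nat.le_floor (by push_cast; nlinarith)
  refine (Nat.log_eq_iff (Or.inr ⟨one_lt_two, ?_⟩)).2 ⟨hlow, ?_⟩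
  · have : 0 < 2 ^ n := by positivity
    omega
  · rw [Nat.floor_lt (by positivity)]
    push_cast
    rw [pow_succ]
    nlinarith

lemma tendsto_floor_mul_two_pow_atTop {x : ℝ} (hx : 0 < x) :
    Tendsto (fun n : ℕ => ⌊x * 2 ^ n⌋₊) atTop atTop :=
  tendsto_nat_floor_atTop.comp
    ((tendsto_pow_atTop_atTop_of_one_lt one_lt_two).const_mul_atTop hx)

lemma tendsto_dyadicGap_floor {x : ℝ} (h1 : 1 ≤ x) (h2 : x < 2) :
    Tendsto (fun n : ℕ => dyadicGap ((⌊x * 2 ^ n⌋₊ : ℝ) / 2 ^ Nat.log 2 ⌊x * 2 ^ n⌋₊) -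
      (2 + (Nat.log 2 ⌊x * 2 ^ n⌋₊ : ℝ)) / ⌊x * 2 ^ n⌋₊) atTop (nhds (dyadicGap x)) := by
  have hx : 0 < x := by linarith
  have hfl : Tendsto (fun n : ℕ => (⌊x * 2 ^ n⌋₊ : ℝ) / 2 ^ n) atTop (nhds x) :=
    (tendsto_nat_floor_mul_div_atTop hx.le).comp
      (tendsto_pow_atTop_atTop_of_one_lt (one_lt_two (α := ℝ)))
  have h := ((continuousAt_dyadicGap hx).tendsto.comp hfl).sub
    (tendsto_two_add_log_two_div_atTop.comp (tendsto_floor_mul_two_pow_atTop hx))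
  rw [sub_zero] at h
  refine h.congr fun n => ?_
  simp only [Function.comp_apply, log_two_floor_mul_two_pow h1 h2 n]

/-- Expected optimal codelength for the uniform distribution on `M` elements:
the optimal compressor `g M` assigns the `(i+1)`-st element a string of length
`⌊log₂ (i+1)⌋` (the `(i+1)`-st binary string in lexicographic order).  Then
`E[ℓ(f*(X_M))] = ⌊log₂ M⌋ + (1/M)(2 + ⌊log₂ M⌋ − 2^{⌊log₂ M⌋+1})`, which equals
`((M+1)log₂(M+1))/M − 2` when `M+1` is a power of 2; moreover
`limsup_M (H(X_M) − E[ℓ(f*(X_M))]) = 2` and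
`liminf_M (H(X_M) − E[ℓ(f*(X_M))]) = 1 + log₂ e − log₂ log₂ e`, where
`H(X_M) = log₂ M`. -/
theorem uniform_expected_optimal_length
    (g : (M : ℕ) → Fin M → List Bool)
    (hginj : ∀ M, Function.Injective (g M))
    (hglen : ∀ M (i : Fin M), (g M i).length = Nat.log 2 ((i : ℕ) + 1)) :
    (∀ M : ℕ, 1 ≤ M →
      (∑ i : Fin M, ((g M i).length : ℝ)) / M =
        (Nat.log 2 M : ℝ) +
          (1 / (M : ℝ)) * (2 + (Nat.log 2 M : ℝ) - (2 : ℝ) ^ (Nat.log 2 M + 1))) ∧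
    (∀ M : ℕ, 1 ≤ M → (∃ j : ℕ, M + 1 = 2 ^ j) →
      (∑ i : Fin M, ((g M i).length : ℝ)) / M =
        (((M : ℝ) + 1) * Real.logb 2 ((M : ℝ) + 1)) / M - 2) ∧
    (Filter.limsup
        (fun M : ℕ => Real.logb 2 M - (∑ i : Fin M, ((g M i).length : ℝ)) / M)
        atTop = 2) ∧
    (Filter.liminf
        (fun M : ℕ => Real.logb 2 M - (∑ i : Fin M, ((g M i).length : ℝ)) / M)
        atTop =
      1 + Real.logb 2 (Real.exp 1) - Real.logb 2 (Real.logb 2 (Real.exp 1))) := by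
  have hE : ∀ M : ℕ, 1 ≤ M → (∑ i : Fin M, ((g M i).length : ℝ)) / M =
      (Nat.log 2 M : ℝ) +
        (1 / (M : ℝ)) * (2 + (Nat.log 2 M : ℝ) - (2 : ℝ) ^ (Nat.log 2 M + 1)) := by
    intro M hM
    have hM' : (M : ℝ) ≠ 0 := by positivity
    have hsum := congrArg (Nat.cast : ℕ → ℝ) (sum_range_log_two_succ M)
    push_cast at hsum
    simp only [hglen]
    rw [Fin.sum_univ_eq_sum_range (fun i => (Nat.log 2 (i + 1) : ℝ)), eq_sub_of_add_eq hsum]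
    field_simp
    ring
  have hgap : ∀ M : ℕ, 1 ≤ M →
      Real.logb 2 M - (∑ i : Fin M, ((g M i).length : ℝ)) / M =
        dyadicGap (M / 2 ^ Nat.log 2 M) - (2 + (Nat.log 2 M : ℝ)) / M := fun M hM => by
    rw [hE M hM, logb_sub_eq_dyadicGap_sub hM]
  have hlim : ∀ x : ℝ, 1 ≤ x → x < 2 → Tendsto (fun n : ℕ => Real.logb 2 ⌊x * 2 ^ n⌋₊ -
      (∑ i : Fin ⌊x * 2 ^ n⌋₊, ((g ⌊x * 2 ^ n⌋₊ i).length : ℝ)) / ⌊x * 2 ^ n⌋₊)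
      atTop (nhds (dyadicGap x)) := fun x h1 h2 =>
    (tendsto_dyadicGap_floor h1 h2).congr' <| by
      filter_upwards [(tendsto_floor_mul_two_pow_atTop (by linarith)).eventually_ge_atTop 1]
        with n hn using (hgap _ hn).symm
  refine ⟨hE, ?_, ?_, ?_⟩
  · rintro M hM ⟨j, hj⟩
    have hM' : (M : ℝ) ≠ 0 := by positivity
    obtain ⟨n, rfl⟩ : ∃ n, j = n + 1 := Nat.exists_eq_succ_of_ne_zero (by rintro rfl; omega)
    have hp : 0 < 2 ^ n := by positivity
    have hn : Nat.log 2 M = n := (Nat.log_eq_iff (Or.inr ⟨one_lt_two, by omega⟩)).2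
      ⟨by rw [pow_succ] at hj; omega, by omega⟩
    have hj' : (M : ℝ) + 1 = 2 ^ (n + 1) := by exact_mod_cast hj
    rw [hE M hM, hn, ← hj']
    nth_rw 3 [hj']
    rw [Real.logb_pow, Real.logb_self_eq_one one_lt_two]
    push_cast
    field_simp
    ring
  · refine limsup_eq_of_tendsto_comp (tendsto_floor_mul_two_pow_atTop one_pos) ?_ fun b hb => ?_
    · simpa [dyadicGap] using hlim 1 le_rfl one_lt_two
    · filter_upwards [eventually_ge_atTop 1] with M hM
      have hp : (0 : ℝ) < 2 ^ Nat.log 2 M := by positivity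
      have hlow : ((2 ^ Nat.log 2 M : ℕ) : ℝ) ≤ M :=
        Nat.cast_le.2 (Nat.pow_log_le_self 2 (by omega))
      have hup : (M : ℝ) < ((2 ^ (Nat.log 2 M + 1) : ℕ) : ℝ) :=
        Nat.cast_lt.2 (Nat.lt_pow_succ_log_self one_lt_two M)
      push_cast at hlow hup
      rw [pow_succ] at hup
      have h := dyadicGap_le_two ((one_le_div hp).2 hlow) ((div_le_iff₀ hp).2 (by linarith))
      have he : 0 ≤ (2 + (Nat.log 2 M : ℝ)) / M := by positivity
      rw [hgap M hM]
      linarith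
  · rw [← dyadicGap_two_mul_log_two]
    refine liminf_eq_of_tendsto_comp
      (tendsto_floor_mul_two_pow_atTop (by linarith [one_le_two_mul_log_two]))
      (hlim _ one_le_two_mul_log_two (by linarith [Real.log_two_lt_d9])) fun b hb => ?_
    filter_upwards [eventually_ge_atTop 1,
      tendsto_two_add_log_two_div_atTop.eventually (eventually_le_nhds (sub_pos.2 hb))]
      with M hM hsmall
    have h := dyadicGap_two_mul_log_two_le (x := (M : ℝ) / 2 ^ Nat.log 2 M) (by positivity)
    rw [hgap M hM]
    linarith
end

section
/- Let X = {P_{X^n}}_{n≥1} be a discrete source over a finite alphabet 𝒜 with finite entropy rate H(X) = limsup_{n→∞} (1/n)·H(X^n) < ∞. Then the normalized minimal expected codelength R̄(n) = (1/n)·E[ℓ(f_n*(X^n))], where f_n* is an optimal compressor for P_{X^n}, satisfies limsup_{n→∞} R̄(n) = H(X). -/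
open scoped BigOperators
open Filter

/-- Adding a null sequence does not change the limsup of a bounded real function. -/
lemma limsup_eq_of_tendsto_sub_zero {ι : Type*} {l : Filter ι} [l.NeBot] {u v : ι → ℝ}
    (h : Tendsto (fun i => u i - v i) l (nhds 0))
    (hle : l.IsBoundedUnder (· ≤ ·) v) (hge : l.IsBoundedUnder (· ≥ ·) v) :
    limsup u l = limsup v l := by
  have huv : (fun i => u i - v i) + v = u := by ext i; simp
  have hvu : v + (fun i => u i - v i) = u := by ext i; simp
  apply le_antisymm
  · have := limsup_add_le h.isBoundedUnder_ge h.isBoundedUnder_le hge.isCoboundedUnder_le hle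
    rwa [huv, h.limsup_eq, zero_add] at this
  · have := le_limsup_add hle hge.isCoboundedUnder_le h.isBoundedUnder_le h.isBoundedUnder_ge
    rwa [hvu, h.liminf_eq, add_zero] at this

/-- The binary logarithm of `2 * (1 + n * log N)` is `o(n)`. -/
lemma tendsto_logb_two_mul_one_add_log_pow (N : ℕ) :
    Tendsto (fun n : ℕ => (1 / (n : ℝ)) * Real.logb 2 (2 * (1 + Real.log ((N : ℝ) ^ n))))
      atTop (nhds 0) := by
  have ha : 0 ≤ Real.log N := Real.log_natCast_nonneg N
  set a := Real.log N
  have hlog : Tendsto (fun n : ℕ => Real.log n / (n : ℝ)) atTop (nhds 0) :=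
    Real.isLittleO_log_id_atTop.tendsto_div_nhds_zero.comp tendsto_natCast_atTop_atTop
  have hconst : Tendsto (fun n : ℕ => Real.log (2 * (1 + a)) / (n : ℝ)) atTop (nhds 0) :=
    tendsto_const_div_atTop_nhds_zero_nat _
  have hsum : Tendsto (fun n : ℕ =>
      (Real.log (2 * (1 + a)) / (n : ℝ) + Real.log n / (n : ℝ)) / Real.log 2)
      atTop (nhds 0) := by
    simpa using (hconst.add hlog).div_const (Real.log 2)
  refine squeeze_zero' ?_ ?_ hsum
  · filter_upwards with n
    have : 0 ≤ (n : ℝ) * a := by positivity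
    rw [Real.log_pow]
    exact mul_nonneg (by positivity) (Real.logb_nonneg (by norm_num) (by linarith))
  · filter_upwards [eventually_ge_atTop 1] with n hn
    have hn' : (1 : ℝ) ≤ n := by exact_mod_cast hn
    have h0 : 0 ≤ (n : ℝ) * a := by positivity
    have hl : Real.log (2 * (1 + n * a)) ≤ Real.log (2 * (1 + a)) + Real.log n := by
      rw [← Real.log_mul (by positivity) (by positivity)]
      exact Real.log_le_log (by positivity) (by nlinarith)
    rw [Real.log_pow, Real.logb, one_div_mul_eq_div, div_right_comm, ← add_div]
    have : 0 < Real.log 2 := Real.log_pos (by norm_num)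
    gcongr

/-- Gibbs' inequality for a subprobability weight scaled by `K`, in bits. -/
lemma sum_mul_logb_inv_le {α : Type*} [Fintype α] {p q : α → ℝ} {K : ℝ}
    (hp : ∀ x, 0 ≤ p x) (hp1 : ∑ x, p x = 1) (hq : ∀ x, 0 < q x) (hK : ∑ x, q x ≤ K) :
    ∑ x, p x * Real.logb 2 (1 / p x) ≤
      ∑ x, p x * Real.logb 2 (1 / q x) + Real.logb 2 K := by
  have hne : Nonempty α := by
    by_contra hα
    rw [not_nonempty_iff] at hα
    simp at hp1
  have hK0 : 0 < K := (Finset.sum_pos (fun x _ => hq x) Finset.univ_nonempty).trans_le hK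
  have hlog2 : 0 < Real.log 2 := Real.log_pos (by norm_num)
  have hterm : ∀ x, p x * Real.log (1 / p x) ≤
      p x * Real.log (1 / q x) + p x * Real.log K + (q x / K - p x) := by
    intro x
    rcases (hp x).eq_or_lt with h | h
    · have := div_nonneg (hq x).le hK0.le
      simpa [← h] using this
    · have hqx := hq x
      have h1 := Real.log_le_sub_one_of_pos (show 0 < q x / (K * p x) by positivity)
      rw [Real.log_div hqx.ne' (by positivity), Real.log_mul hK0.ne' h.ne'] at h1
      have h2 := mul_le_mul_of_nonneg_left h1 h.le
      have h3 : p x * (q x / (K * p x) - 1) = q x / K - p x := by field_simp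
      rw [h3] at h2
      simp only [one_div, Real.log_inv]
      linarith
  have hsum := Finset.sum_le_sum fun x (_ : x ∈ Finset.univ) => hterm x
  rw [Finset.sum_add_distrib, Finset.sum_add_distrib, Finset.sum_sub_distrib, hp1,
    ← Finset.sum_mul, hp1, one_mul, ← Finset.sum_div] at hsum
  have hqK : (∑ x, q x) / K ≤ 1 := (div_le_one hK0).2 hK
  simp only [Real.logb, ← mul_div_assoc, ← Finset.sum_div, ← add_div]
  gcongr
  linarith

namespace IsOptimalCode

variable {α : Type*} [Fintype α] {p : α → ℝ} {g : α → List Bool}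

/-- The expected length of an optimal code is at most the entropy. -/
lemma sum_mul_length_le (hp : ∀ x, 0 ≤ p x) (hp1 : ∑ x, p x = 1) (hg : IsOptimalCode p g) :
    ∑ x, p x * ((g x).length : ℝ) ≤ ∑ x, p x * Real.logb 2 (1 / p x) := by
  classical
  obtain ⟨-, rank, -, hseg, hmono, hlen⟩ := hg
  refine Finset.sum_le_sum fun x _ => ?_
  rcases (hp x).eq_or_lt with h | h
  · simp [← h]
  have hcard : rank x + 1 ≤ (Finset.univ.filter fun y => rank y ≤ rank x).card := by
    have hsub : Finset.range (rank x + 1) ⊆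
        (Finset.univ.filter fun y => rank y ≤ rank x).image rank := by
      intro m hm
      have hm' : m ≤ rank x := Nat.lt_succ_iff.1 (Finset.mem_range.1 hm)
      obtain ⟨y, rfl⟩ := hseg x m hm'
      exact Finset.mem_image_of_mem _ (by simpa using hm')
    simpa using (Finset.card_le_card hsub).trans Finset.card_image_le
  have hmass : ((rank x + 1 : ℕ) : ℝ) * p x ≤ 1 := by
    calc ((rank x + 1 : ℕ) : ℝ) * p x
        ≤ ((Finset.univ.filter fun y => rank y ≤ rank x).card : ℝ) * p x := by gcongr
      _ = ∑ y ∈ Finset.univ.filter fun y => rank y ≤ rank x, p x := by simp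
      _ ≤ ∑ y ∈ Finset.univ.filter fun y => rank y ≤ rank x, p y :=
          Finset.sum_le_sum fun y hy => hmono y x (by simpa using hy)
      _ ≤ ∑ y, p y := Finset.sum_le_univ_sum_of_nonneg hp
      _ = 1 := hp1
  rw [hlen]
  gcongr
  calc ((Nat.log 2 (rank x + 1) : ℕ) : ℝ) ≤ Real.logb 2 ((rank x + 1 : ℕ) : ℝ) := by
        exact_mod_cast Real.natLog_le_logb (rank x + 1) 2
    _ ≤ Real.logb 2 (1 / p x) :=
        Real.logb_le_logb_of_le (by norm_num) (by positivity) ((le_div_iff₀ h).2 hmass)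

lemma rank_lt_card {rank : α → ℕ} (hseg : ∀ x m, m ≤ rank x → ∃ y, rank y = m) (x : α) :
    rank x < Fintype.card α := by
  classical
  have hsub : Finset.range (rank x + 1) ⊆ Finset.univ.image rank := by
    intro m hm
    obtain ⟨y, rfl⟩ := hseg x m (Nat.lt_succ_iff.1 (Finset.mem_range.1 hm))
    exact Finset.mem_image_of_mem _ (Finset.mem_univ y)
  simpa using (Finset.card_le_card hsub).trans Finset.card_image_le

lemma length_le_logb_card (hg : IsOptimalCode p g) (x : α) :
    ((g x).length : ℝ) ≤ Real.logb 2 (Fintype.card α) := by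
  obtain ⟨-, rank, -, hseg, -, hlen⟩ := hg
  rw [hlen]
  exact (Nat.cast_le.2 (Nat.log_mono_right (rank_lt_card hseg x))).trans
    (by exact_mod_cast Real.natLog_le_logb (Fintype.card α) 2)

/-- The Kraft sum of an optimal code grows at most logarithmically in the alphabet size. -/
lemma sum_inv_two_pow_length_le (hg : IsOptimalCode p g) :
    ∑ x, ((2 : ℝ) ^ (g x).length)⁻¹ ≤ 2 * (1 + Real.log (Fintype.card α)) := by
  classical
  obtain ⟨-, rank, hinj, hseg, -, hlen⟩ := hg
  calc ∑ x, ((2 : ℝ) ^ (g x).length)⁻¹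
      ≤ ∑ x, 2 * ((rank x + 1 : ℕ) : ℝ)⁻¹ := by
        refine Finset.sum_le_sum fun x _ => ?_
        have h : ((rank x + 1 : ℕ) : ℝ) ≤ 2 ^ (g x).length * 2 := by
          rw [hlen, ← pow_succ]
          exact_mod_cast (Nat.lt_pow_succ_log_self one_lt_two (rank x + 1)).le
        rw [inv_le_iff_one_le_mul₀ (by positivity), mul_right_comm, ← div_eq_mul_inv,
          one_le_div (by positivity)]
        linarith
    _ = 2 * ∑ k ∈ Finset.univ.image rank, ((k + 1 : ℕ) : ℝ)⁻¹ := by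
        rw [Finset.sum_image fun x _ y _ h => hinj h, Finset.mul_sum]
    _ ≤ 2 * ∑ k ∈ Finset.range (Fintype.card α), ((k + 1 : ℕ) : ℝ)⁻¹ := by
        gcongr
        intro m hm
        obtain ⟨x, -, rfl⟩ := Finset.mem_image.1 hm
        exact Finset.mem_range.2 (rank_lt_card hseg x)
    _ ≤ 2 * (1 + Real.log (Fintype.card α)) := by
        have h := harmonic_le_one_add_log (Fintype.card α)
        simp only [harmonic, Rat.cast_sum, Rat.cast_inv, Rat.cast_natCast] at h
        gcongr

/-- The entropy exceeds the expected length of an optimal code by at most a doubly logarithmic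
term in the alphabet size. -/
lemma entropy_le (hp : ∀ x, 0 ≤ p x) (hp1 : ∑ x, p x = 1) (hg : IsOptimalCode p g) :
    ∑ x, p x * Real.logb 2 (1 / p x) ≤
      ∑ x, p x * ((g x).length : ℝ) + Real.logb 2 (2 * (1 + Real.log (Fintype.card α))) := by
  simpa [Real.logb_pow] using
    sum_mul_logb_inv_le hp hp1 (fun x => by positivity) hg.sum_inv_two_pow_length_le

end IsOptimalCode

/-- For any discrete source `{P_{X^n}}` over a finite alphabet `𝒜` with finite entropy
rate `H = limsup (1/n)H(X^n)`, the normalized minimal expected codelength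
`R̄(n) = (1/n)E[ℓ(f_n*(X^n))]` satisfies `limsup_n R̄(n) = H`. -/
theorem limsup_normalized_expected_length
    {𝒜 : Type*} [Fintype 𝒜]
    (P : (n : ℕ) → (Fin n → 𝒜) → ℝ)
    (hP0 : ∀ n x, 0 ≤ P n x) (hP1 : ∀ n, ∑ x, P n x = 1)
    (g : (n : ℕ) → (Fin n → 𝒜) → List Bool)
    (hg : ∀ n, IsOptimalCode (P n) (g n))
    (H : ℝ)
    (hH : Filter.limsup
        (fun n : ℕ => (1 / (n : ℝ)) * ∑ x, P n x * Real.logb 2 (1 / P n x))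
        atTop = H) :
    Filter.limsup
        (fun n : ℕ => (1 / (n : ℝ)) * ∑ x, P n x * ((g n x).length : ℝ))
        atTop = H := by
  rw [← hH]
  symm
  apply limsup_eq_of_tendsto_sub_zero
  · refine squeeze_zero (fun n => ?_) (fun n => ?_)
      (tendsto_logb_two_mul_one_add_log_pow (Fintype.card 𝒜))
    · rw [← mul_sub]
      exact mul_nonneg (by positivity)
        (sub_nonneg.2 ((hg n).sum_mul_length_le (hP0 n) (hP1 n)))
    · rw [← mul_sub]
      have h := (hg n).entropy_le (hP0 n) (hP1 n)
      simp only [Fintype.card_fun, Fintype.card_fin, Nat.cast_pow] at h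
      gcongr
      linarith
  · refine isBoundedUnder_of_eventually_le (a := Real.logb 2 (Fintype.card 𝒜)) ?_
    filter_upwards [eventually_gt_atTop 0] with n hn
    have hn' : (0 : ℝ) < n := by exact_mod_cast hn
    rw [one_div_mul_eq_div, div_le_iff₀' hn', ← Real.logb_pow]
    calc ∑ x, P n x * ((g n x).length : ℝ)
        ≤ ∑ x, P n x * Real.logb 2 ((Fintype.card 𝒜 : ℝ) ^ n) := by
          refine Finset.sum_le_sum fun x _ => mul_le_mul_of_nonneg_left ?_ (hP0 n x)
          simpa using (hg n).length_le_logb_card x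
      _ = Real.logb 2 ((Fintype.card 𝒜 : ℝ) ^ n) := by
          rw [← Finset.sum_mul, hP1, one_mul]
  · refine isBoundedUnder_of_eventually_ge (a := 0) (Eventually.of_forall fun n => ?_)
    exact mul_nonneg (by positivity)
      (Finset.sum_nonneg fun x _ => mul_nonneg (hP0 n x) (Nat.cast_nonneg _))
end

section
/- Let {P_{X^{(n)}}}_{n≥1} be an arbitrary (not necessarily serial) sequence of discrete sources, with X^{(n)} taking values in a finite alphabet 𝒜_n, such that the entropies H(X^{(n)}) → ∞ as n → ∞. Then the minimal expected codelength satisfies lim_{n→∞} E[ℓ(f_n*(X^{(n)}))] / H(X^{(n)}) = 1, where f_n* is an optimal compressor for P_{X^{(n)}}. -/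
open scoped BigOperators
open Filter

/-- The element of rank `m` has probability at most `1 / (m + 1)`. -/
lemma rank_succ_mul_le_one {α : Type*} [Fintype α] {P : α → ℝ}
    (hP0 : ∀ x, 0 ≤ P x) (hP1 : ∑ x, P x = 1) {rank : α → ℕ}
    (hseg : ∀ x m, m ≤ rank x → ∃ y, rank y = m)
    (hanti : ∀ x y, rank x ≤ rank y → P y ≤ P x) (x : α) :
    ((rank x : ℝ) + 1) * P x ≤ 1 := by
  classical
  set s : Finset α := Finset.univ.filter fun y => rank y ≤ rank x with hs
  have hcard : rank x + 1 ≤ s.card := by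
    have hsub : Finset.range (rank x + 1) ⊆ s.image rank := by
      intro m hm
      have hm' : m ≤ rank x := Nat.lt_succ_iff.mp (Finset.mem_range.mp hm)
      obtain ⟨y, hy⟩ := hseg x m hm'
      exact Finset.mem_image.mpr ⟨y, by simp [hs, hy, hm'], hy⟩
    calc rank x + 1 = (Finset.range (rank x + 1)).card := (Finset.card_range _).symm
      _ ≤ (s.image rank).card := Finset.card_le_card hsub
      _ ≤ s.card := Finset.card_image_le
  calc ((rank x : ℝ) + 1) * P x ≤ (s.card : ℝ) * P x :=
        mul_le_mul_of_nonneg_right (by exact_mod_cast hcard) (hP0 x)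
    _ = ∑ _y ∈ s, P x := by simp
    _ ≤ ∑ y ∈ s, P y := Finset.sum_le_sum fun y hy => hanti y x (by simpa [hs] using hy)
    _ ≤ ∑ y, P y := Finset.sum_le_univ_sum_of_nonneg hP0
    _ = 1 := hP1

/-- The expected length of an optimal code is at most the entropy. -/
lemma IsOptimalCode.expected_length_le_entropy {α : Type*} [Fintype α] {P : α → ℝ}
    {g : α → List Bool} (hg : IsOptimalCode P g)
    (hP0 : ∀ x, 0 ≤ P x) (hP1 : ∑ x, P x = 1) :
    ∑ x, P x * ((g x).length : ℝ) ≤ ∑ x, P x * Real.logb 2 (1 / P x) := by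
  obtain ⟨-, rank, -, hseg, hanti, hlen⟩ := hg
  refine Finset.sum_le_sum fun x _ => ?_
  rcases (hP0 x).eq_or_lt with h | h
  · simp [← h]
  refine mul_le_mul_of_nonneg_left ?_ h.le
  have hk : (0 : ℝ) < (rank x : ℝ) + 1 := by positivity
  calc ((g x).length : ℝ) = (Nat.log 2 (rank x + 1) : ℝ) := by rw [hlen]
    _ ≤ Real.logb 2 ((rank x + 1 : ℕ) : ℝ) := Real.natLog_le_logb _ _
    _ ≤ Real.logb 2 (1 / P x) := by
        push_cast
        exact Real.logb_le_logb_of_le one_lt_two hk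
          ((le_div_iff₀ h).mpr (rank_succ_mul_le_one hP0 hP1 hseg hanti x))

/-- Gibbs' inequality against a positive weight of total mass at most `C`. -/
lemma entropy_le_sum_mul_logb {α : Type*} [Fintype α] {P W : α → ℝ}
    (hP0 : ∀ x, 0 ≤ P x) (hP1 : ∑ x, P x = 1) (hW : ∀ x, 0 < W x) {C : ℝ} (hC : 0 < C)
    (hWC : ∑ x, W x ≤ C) :
    ∑ x, P x * Real.logb 2 (1 / P x) ≤
      ∑ x, P x * Real.logb 2 (1 / W x) + Real.logb 2 C := by
  have hlog : 0 < Real.log 2 := Real.log_pos one_lt_two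
  have hterm : ∀ x, P x * Real.log (1 / P x) ≤
      P x * Real.log (1 / W x) + P x * Real.log C + (W x / C - P x) := by
    intro x
    rcases (hP0 x).eq_or_lt with h | h
    · simpa [← h] using (div_pos (hW x) hC).le
    have h1 := Real.log_le_sub_one_of_pos (div_pos (hW x) (mul_pos hC h))
    rw [Real.log_div (hW x).ne' (mul_pos hC h).ne', Real.log_mul hC.ne' h.ne'] at h1
    have h2 := mul_le_mul_of_nonneg_left h1 h.le
    have h3 : P x * (W x / (C * P x) - 1) = W x / C - P x := by
      field_simp
    rw [h3] at h2
    simp only [one_div, Real.log_inv]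
    linarith
  have hsum := Finset.sum_le_sum fun x (_ : x ∈ Finset.univ) => hterm x
  simp only [Finset.sum_add_distrib, Finset.sum_sub_distrib, ← Finset.sum_mul,
    ← Finset.sum_div, hP1, one_mul] at hsum
  have hWC' : (∑ x, W x) / C ≤ 1 := (div_le_one hC).mpr hWC
  simp only [Real.logb, mul_div_assoc', ← Finset.sum_div, ← add_div]
  exact div_le_div_of_nonneg_right (by linarith) hlog.le

/-- For every `s > 1`, the entropy is at most `s` times the expected length of an optimal code,
up to an additive constant depending only on `s`. -/
lemma IsOptimalCode.entropy_le_s13 {α : Type*} [Fintype α] {P : α → ℝ}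
    {g : α → List Bool} (hg : IsOptimalCode P g)
    (hP0 : ∀ x, 0 ≤ P x) (hP1 : ∑ x, P x = 1) {s : ℝ} (hs : 1 < s) :
    ∑ x, P x * Real.logb 2 (1 / P x) ≤
      s * ∑ x, P x * ((g x).length : ℝ) +
        (s + Real.logb 2 (∑' n : ℕ, 1 / ((n + 1 : ℕ) : ℝ) ^ s)) := by
  obtain ⟨-, rank, hinj, -, -, hlen⟩ := hg
  have hsummable : Summable fun n : ℕ => 1 / ((n + 1 : ℕ) : ℝ) ^ s :=
    (summable_nat_add_iff 1).mpr (Real.summable_one_div_nat_rpow.mpr hs)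
  have hpos : ∀ n : ℕ, 0 < 1 / ((n + 1 : ℕ) : ℝ) ^ s := fun n => by positivity
  have hC := hsummable.tsum_pos (fun n => (hpos n).le) 0 (hpos 0)
  have hWC : ∑ x, 1 / ((rank x + 1 : ℕ) : ℝ) ^ s ≤ ∑' n : ℕ, 1 / ((n + 1 : ℕ) : ℝ) ^ s := by
    have h := hsummable.sum_le_tsum (Finset.univ.map ⟨rank, hinj⟩) fun n _ => (hpos n).le
    rwa [Finset.sum_map] at h
  have hgibbs := entropy_le_sum_mul_logb hP0 hP1 (fun x => hpos (rank x)) hC hWC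
  have hlen' : ∀ x, Real.logb 2 (1 / (1 / ((rank x + 1 : ℕ) : ℝ) ^ s)) ≤
      s * ((g x).length + 1) := by
    intro x
    have hk : (0 : ℝ) < ((rank x + 1 : ℕ) : ℝ) := by positivity
    rw [one_div_one_div, Real.logb_rpow_eq_mul_logb_of_pos hk, hlen]
    refine mul_le_mul_of_nonneg_left ?_ (by linarith)
    rw [Real.logb_le_iff_le_rpow one_lt_two hk]
    exact_mod_cast (Nat.lt_pow_succ_log_self one_lt_two (rank x + 1)).le
  have hbound : ∑ x, P x * Real.logb 2 (1 / (1 / ((rank x + 1 : ℕ) : ℝ) ^ s)) ≤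
      s * ∑ x, P x * ((g x).length : ℝ) + s := by
    calc _ ≤ ∑ x, P x * (s * ((g x).length + 1)) :=
          Finset.sum_le_sum fun x _ => mul_le_mul_of_nonneg_left (hlen' x) (hP0 x)
      _ = ∑ x, (s * (P x * (g x).length) + s * P x) :=
          Finset.sum_congr rfl fun x _ => by ring
      _ = _ := by rw [Finset.sum_add_distrib, ← Finset.mul_sum, ← Finset.mul_sum, hP1, mul_one]
  linarith

/-- For any (not necessarily serial) sequence of discrete sources `X^{(n)}` on finite
alphabets with entropies `H(X^{(n)}) → ∞`, the minimal expected codelength satisfies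
`E[ℓ(f_n*(X^{(n)}))]/H(X^{(n)}) → 1`. -/
theorem expected_length_div_entropy_tendsto_one
    (α : ℕ → Type*) [∀ n, Fintype (α n)]
    (P : (n : ℕ) → α n → ℝ)
    (hP0 : ∀ n x, 0 ≤ P n x) (hP1 : ∀ n, ∑ x, P n x = 1)
    (g : (n : ℕ) → α n → List Bool)
    (hg : ∀ n, IsOptimalCode (P n) (g n))
    (hH : Filter.Tendsto
        (fun n : ℕ => ∑ x, P n x * Real.logb 2 (1 / P n x)) atTop atTop) :
    Filter.Tendsto
      (fun n : ℕ =>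
        (∑ x, P n x * ((g n x).length : ℝ)) /
          (∑ x, P n x * Real.logb 2 (1 / P n x)))
      atTop (nhds 1) := by
  refine tendsto_order.mpr ⟨fun a ha => ?_, fun a ha => ?_⟩
  · obtain ⟨b, hab, hb⟩ : ∃ b, a ≤ b ∧ 0 ≤ b ∧ b < 1 :=
      ⟨max a 0, le_max_left _ _, le_max_right _ _, max_lt ha one_pos⟩
    obtain ⟨s, hs, hsb⟩ : ∃ s : ℝ, 1 < s ∧ s * b < 1 := by
      refine ⟨2 / (1 + b), ?_, ?_⟩
      · rw [lt_div_iff₀] <;> linarith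
      · rw [div_mul_eq_mul_div, div_lt_one] <;> linarith
    set K : ℝ := s + Real.logb 2 (∑' n : ℕ, 1 / ((n + 1 : ℕ) : ℝ) ^ s)
    filter_upwards [hH.eventually_gt_atTop 0, hH.eventually_gt_atTop (K / (1 - s * b))]
      with n hn0 hnK
    refine hab.trans_lt ((lt_div_iff₀ hn0).mpr ?_)
    have hle := (hg n).entropy_le_s13 (hP0 n) (hP1 n) hs
    rw [div_lt_iff₀ (by linarith)] at hnK
    refine lt_of_mul_lt_mul_left (a := s) ?_ (by linarith)
    linarith
  · filter_upwards [hH.eventually_gt_atTop 0] with n hn0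
    exact ((div_le_one hn0).mpr
      ((hg n).expected_length_le_entropy (hP0 n) (hP1 n))).trans_lt ha
end
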